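/- arXiv:2510.17222 — 12 statements merged into one kernel-verified Lean document; each statement's English description precedes it below -/
import Mathlib

section
/- Let H be a Hopf algebra over a field k and let x : H → k be a k-linear functional. Define the k-linear map η_x : H ⊗ H → H on pure tensors by η_x(f ⊗ g) = x(S(f·S(g₍₁₎)))·g₍₂₎. Then for all f, g, h ∈ H one has η_x((f ⊗ g)·Δ(h)) = η_x(f ⊗ g)·h, where (f ⊗ g)·Δ(h) denotes the product in the algebra H ⊗ H. -/
open TensorProduct

namespace HopfAlgebra

open Coalgebra

variable {R A : Type*} [CommSemiring R] [Semiring A] [HopfAlgebra R A]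

variable (R A) in
/-- The linear map `a ⊗ (b ⊗ c) ↦ a * S b ⊗ c`. -/
noncomputable def mulAntipodeTensor : A ⊗[R] (A ⊗[R] A) →ₗ[R] A ⊗[R] A :=
  (LinearMap.mul' R A).rTensor A ∘ₗ (TensorProduct.assoc R A A A).symm.toLinearMap ∘ₗ
    ((antipode R).rTensor A).lTensor A

@[simp]
lemma mulAntipodeTensor_tmul (a b c : A) :
    mulAntipodeTensor R A (a ⊗ₜ (b ⊗ₜ c)) = (a * antipode R b) ⊗ₜ c := by
  simp [mulAntipodeTensor]

lemma lTensor_comul_tmul_mul (f g : A) (u : A ⊗[R] A) :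
    comul.lTensor A ((f ⊗ₜ[R] g) * u) = (f ⊗ₜ[R] comul (R := R) g) * comul.lTensor A u := by
  induction u with
  | zero => simp
  | add u v hu hv => simp [mul_add, hu, hv]
  | tmul a b => simp

lemma mulAntipodeTensor_tmul_mul_assoc (f p q c : A) (v : A ⊗[R] A) :
    mulAntipodeTensor R A ((f ⊗ₜ (p ⊗ₜ q)) * TensorProduct.assoc R A A A (v ⊗ₜ c)) =
      (f * LinearMap.mul' R A ((antipode R).lTensor A v) * antipode R p) ⊗ₜ (q * c) := by
  induction v with
  | zero => simp
  | add u v hu hv => simp [TensorProduct.add_tmul, mul_add, add_mul, hu, hv]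
  | tmul a b => simp [antipode_mul_antidistrib, mul_assoc]

lemma mulAntipodeTensor_tmul_mul_rTensor_comul (f p q : A) (u : A ⊗[R] A) :
    mulAntipodeTensor R A
        ((f ⊗ₜ (p ⊗ₜ q)) * TensorProduct.assoc R A A A (comul.rTensor A u)) =
      mulAntipodeTensor R A (f ⊗ₜ (p ⊗ₜ q)) *
        (Algebra.linearMap R A).rTensor A (counit.rTensor A u) := by
  induction u with
  | zero => simp
  | add u v hu hv => simp only [map_add, mul_add, hu, hv]
  | tmul a b =>
    rw [LinearMap.rTensor_tmul, mulAntipodeTensor_tmul_mul_assoc,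
      mul_antipode_lTensor_comul_apply]
    simp [mul_assoc, Algebra.commutes]

lemma mulAntipodeTensor_tmul_mul_lTensor_comul_comul (f h : A) (t : A ⊗[R] A) :
    mulAntipodeTensor R A ((f ⊗ₜ t) * comul.lTensor A (comul h)) =
      mulAntipodeTensor R A (f ⊗ₜ t) * (1 ⊗ₜ h) := by
  induction t with
  | zero => simp
  | add u v hu hv => simp only [TensorProduct.tmul_add, map_add, add_mul, hu, hv]
  | tmul p q =>
    rw [← coassoc_apply, mulAntipodeTensor_tmul_mul_rTensor_comul, rTensor_counit_comul]
    simp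

lemma lid_rTensor_mul_one_tmul (y : A →ₗ[R] R) (u : A ⊗[R] A) (h : A) :
    TensorProduct.lid R A (y.rTensor A (u * (1 ⊗ₜ h))) =
      TensorProduct.lid R A (y.rTensor A u) * h := by
  induction u with
  | zero => simp
  | add u v hu hv => simp only [map_add, add_mul, hu, hv]
  | tmul a b => simp

end HopfAlgebra

/-- Let `H` be a Hopf algebra over a field `k` with antipode `S`, and let `x : H → k` be a
linear functional. Define `η_x : H ⊗ H → H` by `η_x (f ⊗ g) = ⟨S*(x), f·S(g₍₁₎)⟩ g₍₂₎`,
i.e. `η_x (f ⊗ g) = x(S(f·S(g₍₁₎))) • g₍₂₎` (encoded as the composite of the Fourier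
transform `f ⊗ g ↦ f·S(g₍₁₎) ⊗ g₍₂₎` with `u ⊗ v ↦ x(S u) • v`).  Then for all
`f g h : H`: `η_x ((f ⊗ g) · Δ(h)) = η_x (f ⊗ g) · h`, the product `(f ⊗ g) · Δ(h)`
being taken in the tensor product algebra `H ⊗ H`. -/
theorem eta_right_module_map (k H : Type*) [Field k] [Ring H] [HopfAlgebra k H]
    (x : H →ₗ[k] k) :
    let S : H →ₗ[k] H := HopfAlgebra.antipode (R := k)
    -- the Fourier transform 𝓕 : f ⊗ g ↦ f·S(g₍₁₎) ⊗ g₍₂₎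
    let F : H ⊗[k] H →ₗ[k] H ⊗[k] H :=
      (LinearMap.mul' k H).rTensor H ∘ₗ (TensorProduct.assoc k H H H).symm.toLinearMap ∘ₗ
        (S.rTensor H ∘ₗ Coalgebra.comul).lTensor H
    -- η_x : f ⊗ g ↦ x(S(f·S(g₍₁₎))) • g₍₂₎
    let eta : H ⊗[k] H →ₗ[k] H :=
      (TensorProduct.lid k H).toLinearMap ∘ₗ (x ∘ₗ S).rTensor H ∘ₗ F
    ∀ f g h : H, eta ((f ⊗ₜ[k] g) * Coalgebra.comul h) = eta (f ⊗ₜ[k] g) * h := by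
  intro S F eta f g h
  have hF (u : H ⊗[k] H) :
      F u = HopfAlgebra.mulAntipodeTensor k H (Coalgebra.comul.lTensor H u) := by
    simp [F, S, HopfAlgebra.mulAntipodeTensor, LinearMap.lTensor_comp]
  simp only [eta, LinearMap.comp_apply, LinearEquiv.coe_coe, hF,
    HopfAlgebra.lTensor_comul_tmul_mul,
    HopfAlgebra.mulAntipodeTensor_tmul_mul_lTensor_comul_comul,
    HopfAlgebra.lid_rTensor_mul_one_tmul, LinearMap.lTensor_tmul]
end

section
/- Let H be a Hopf algebra over a field k, let X = H* = Hom_k(H, k) be its dual equipped with the convolution product (x·y)(g) = x(g₍₁₎)·y(g₍₂₎), and let h ∈ H be a left integral, i.e. a·h = ε(a)·h for all a ∈ H. Define ξ : X → X by ξ(x)(g) = x(g·h). Then ξ is an averaging operator on the convolution algebra X, i.e. ξ(ξ(x)·y) = ξ(x)·ξ(y) = ξ(x·ξ(y)) for all x, y ∈ X. -/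
open TensorProduct

/-- A scalar multiple of the counit acts from the left, under convolution, as that scalar. -/
theorem mul'_comp_map_left_smul_counit_comp_comul {k C : Type*} [CommSemiring k] [AddCommMonoid C]
    [Module k C] [Coalgebra k C] (c : k) (z : C →ₗ[k] k) :
    LinearMap.mul' k k ∘ₗ TensorProduct.map (c • Coalgebra.counit) z ∘ₗ Coalgebra.comul =
      c • z := by
  ext g
  have key : LinearMap.mul' k k ∘ₗ TensorProduct.map (c • (Coalgebra.counit : C →ₗ[k] k)) z =
      c • (LinearMap.mul' k k ∘ₗ z.lTensor k ∘ₗ LinearMap.rTensor C Coalgebra.counit) := by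
    ext a b
    simp [mul_assoc]
  simp only [← LinearMap.comp_assoc, key, LinearMap.smul_comp]
  simp only [LinearMap.comp_assoc, Coalgebra.rTensor_counit_comp_comul]
  simp

/-- A scalar multiple of the counit acts from the right, under convolution, as that scalar. -/
theorem mul'_comp_map_right_smul_counit_comp_comul {k C : Type*} [CommSemiring k] [AddCommMonoid C]
    [Module k C] [Coalgebra k C] (c : k) (z : C →ₗ[k] k) :
    LinearMap.mul' k k ∘ₗ TensorProduct.map z (c • Coalgebra.counit) ∘ₗ Coalgebra.comul =
      c • z := by
  ext g
  have key : LinearMap.mul' k k ∘ₗ TensorProduct.map z (c • (Coalgebra.counit : C →ₗ[k] k)) =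
      c • (LinearMap.mul' k k ∘ₗ z.rTensor k ∘ₗ LinearMap.lTensor C Coalgebra.counit) := by
    ext a b
    simp [mul_left_comm]
  simp only [← LinearMap.comp_assoc, key, LinearMap.smul_comp]
  simp only [LinearMap.comp_assoc, Coalgebra.lTensor_counit_comp_comul]
  simp

/-- Let `H` be a Hopf algebra over a field `k`, let `X = H* = Hom_k(H, k)` with the
convolution product `(x·y)(g) = x(g₍₁₎)·y(g₍₂₎)` (encoded as
`x·y = mul'_k ∘ (x ⊗ y) ∘ Δ`), and let `h ∈ H` be a left integral
(`a·h = ε(a)·h` for all `a`).  Define `ξ : X → X` by `ξ(x)(g) = x(g·h)`.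
Then `ξ` is an averaging operator on the convolution algebra `X`:
`ξ(ξ(x)·y) = ξ(x)·ξ(y) = ξ(x·ξ(y))` for all `x, y ∈ X`. -/
theorem integral_averaging_operator (k H : Type*) [Field k] [Ring H] [HopfAlgebra k H]
    (h : H) (hint : ∀ a : H, a * h = Coalgebra.counit (R := k) a • h) :
    -- the convolution product on X = H* = Hom_k(H, k)
    let conv : (H →ₗ[k] k) → (H →ₗ[k] k) → (H →ₗ[k] k) := fun x y =>
      LinearMap.mul' k k ∘ₗ TensorProduct.map x y ∘ₗ Coalgebra.comul
    -- ξ(x)(g) = x(g·h)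
    let xi : (H →ₗ[k] k) → (H →ₗ[k] k) := fun x => x ∘ₗ LinearMap.mulRight k h
    ∀ x y : H →ₗ[k] k,
      xi (conv (xi x) y) = conv (xi x) (xi y) ∧
      conv (xi x) (xi y) = xi (conv x (xi y)) := by
  intro conv xi x y
  have hxi (z : H →ₗ[k] k) : xi z = z h • Coalgebra.counit := by
    ext g
    simp [xi, hint, mul_comm]
  have hl (c : k) (z : H →ₗ[k] k) : conv (c • Coalgebra.counit) z = c • z :=
    mul'_comp_map_left_smul_counit_comp_comul c z
  have hr (c : k) (z : H →ₗ[k] k) : conv z (c • Coalgebra.counit) = c • z :=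
    mul'_comp_map_right_smul_counit_comp_comul c z
  simp only [hxi, hl, hr, LinearMap.smul_apply, smul_smul, smul_eq_mul, and_true, mul_comm]
end

section
/- Let T₁ and T₂ be averaging operators on A such that T₁ ∘ T₂ = T₂ ∘ T₁. Then T₁ ∘ T₂ is an averaging operator on A. In particular, for every n ≥ 1, the n-th power Tⁿ of an averaging operator T on A is an averaging operator on A. -/
/-- An averaging operator on a (not necessarily unital or commutative) associative
`k`-algebra `A` is a `k`-linear map `T : A → A` with
`T (T a * b) = T a * T b = T (a * T b)` for all `a b : A`. -/
def IsAveragingOperator {k A : Type*} [Field k] [NonUnitalRing A] [Module k A]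
    [SMulCommClass k A A] [IsScalarTower k A A] (T : A →ₗ[k] A) : Prop :=
  ∀ a b : A, T (T a * b) = T a * T b ∧ T a * T b = T (a * T b)

/-- The composition of two commuting averaging operators is an averaging operator. -/
theorem IsAveragingOperator.comp {k A : Type*} [Field k] [NonUnitalRing A] [Module k A]
    [SMulCommClass k A A] [IsScalarTower k A A] {T₁ T₂ : A →ₗ[k] A}
    (h₁ : IsAveragingOperator T₁) (h₂ : IsAveragingOperator T₂)
    (hcomm : T₁ ∘ₗ T₂ = T₂ ∘ₗ T₁) : IsAveragingOperator (T₁ ∘ₗ T₂) := by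
  have hc (x : A) : T₁ (T₂ x) = T₂ (T₁ x) := LinearMap.congr_fun hcomm x
  intro a b
  simp only [LinearMap.comp_apply]
  constructor
  · rw [hc a, (h₂ (T₁ a) b).1, ← hc a, (h₁ (T₂ a) (T₂ b)).1]
  · rw [hc b, ← (h₂ a (T₁ b)).2, ← hc b, ← (h₁ (T₂ a) (T₂ b)).2]

/-- Every positive power of an averaging operator is an averaging operator. -/
theorem IsAveragingOperator.pow {k A : Type*} [Field k] [NonUnitalRing A] [Module k A]
    [SMulCommClass k A A] [IsScalarTower k A A] {T : A →ₗ[k] A}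
    (h : IsAveragingOperator T) {n : ℕ} (hn : 1 ≤ n) : IsAveragingOperator (T ^ n) := by
  induction n, hn using Nat.le_induction with
  | base => simpa using h
  | succ n _ ih =>
    rw [pow_succ]
    exact ih.comp h (Commute.pow_self T n)

/-- If `T₁` and `T₂` are commuting averaging operators on `A`, then `T₁ ∘ T₂` is an
averaging operator on `A`; in particular every power `T ^ n`, `n ≥ 1`, of an averaging
operator `T` is an averaging operator. -/
theorem averaging_comp_of_commute {k A : Type*} [Field k] [CharZero k] [NonUnitalRing A]
    [Module k A] [SMulCommClass k A A] [IsScalarTower k A A]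
    (T₁ T₂ : A →ₗ[k] A) (h₁ : IsAveragingOperator T₁) (h₂ : IsAveragingOperator T₂)
    (hcomm : T₁ ∘ₗ T₂ = T₂ ∘ₗ T₁) :
    IsAveragingOperator (T₁ ∘ₗ T₂) ∧
      ∀ (T : A →ₗ[k] A), IsAveragingOperator T → ∀ n : ℕ, 1 ≤ n →
        IsAveragingOperator (T ^ n) := by
  exact ⟨h₁.comp h₂ hcomm, fun _ h _ hn => h.pow hn⟩
end

section
/- Let T be an averaging operator on A which is bijective. Then the inverse map T⁻¹ : A → A is also an averaging operator on A. -/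
/-- If `T` is a bijective averaging operator on `A`, then its inverse is also an
averaging operator on `A`. -/
theorem averaging_inv {k A : Type*} [Field k] [CharZero k] [NonUnitalRing A]
    [Module k A] [SMulCommClass k A A] [IsScalarTower k A A]
    (T : A ≃ₗ[k] A) (hT : IsAveragingOperator (T : A →ₗ[k] A)) :
    IsAveragingOperator (T.symm : A →ₗ[k] A) := by
  intro a b
  have h₁ := hT (T.symm (T.symm a)) (T.symm b)
  have h₂ := hT (T.symm a) (T.symm (T.symm b))
  simp only [LinearEquiv.coe_coe, LinearEquiv.apply_symm_apply] at h₁ h₂ ⊢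
  have h₃ : T (T.symm a * T.symm b) = T.symm a * b := h₁.1
  have h₄ : T (T.symm a * T.symm b) = a * T.symm b := h₂.2.symm
  exact ⟨by rw [← h₃, T.symm_apply_apply], by rw [← h₄, T.symm_apply_apply]⟩
end

section
/- Let T be a bijective averaging operator on A, and let P(t) = c₁t + c₂t² + ... + c_m t^m ∈ k[t] be any polynomial with zero constant term. Then the operator P(T) = c₁T + c₂T² + ... + c_m T^m : A → A is an averaging operator on A. -/
section Centroid

variable {k A : Type*} [Field k] [NonUnitalRing A] [Module k A]

/-- A linear map lies in the centroid of `A` if it commutes with all left and right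
multiplications. -/
def IsCentroidal (S : A →ₗ[k] A) : Prop :=
  ∀ a b : A, S (a * b) = S a * b ∧ S (a * b) = a * S b

theorem IsCentroidal.pow {S : A →ₗ[k] A} (hS : IsCentroidal S) (n : ℕ) :
    IsCentroidal (S ^ n) := by
  induction n with
  | zero => exact fun a b => ⟨rfl, rfl⟩
  | succ n ih =>
    intro a b
    simp only [pow_succ', Module.End.mul_apply]
    exact ⟨by rw [(ih a b).1, (hS _ b).1], by rw [(ih a b).2, (hS a _).2]⟩

variable [SMulCommClass k A A] [IsScalarTower k A A]

theorem IsCentroidal.isAveragingOperator {S : A →ₗ[k] A} (hS : IsCentroidal S) :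
    IsAveragingOperator S :=
  fun a b => ⟨(hS (S a) b).2, (hS a (S b)).1.symm⟩

theorem IsAveragingOperator.isCentroidal {T : A →ₗ[k] A} (hT : IsAveragingOperator T)
    (hbij : Function.Bijective T) : IsCentroidal T := by
  intro a b
  constructor
  · obtain ⟨b, rfl⟩ := hbij.2 b
    exact (hT a b).2.symm
  · obtain ⟨a, rfl⟩ := hbij.2 a
    exact (hT a b).1

theorem IsCentroidal.sum_smul {ι : Type*} (s : Finset ι) (c : ι → k) {S : ι → A →ₗ[k] A}
    (hS : ∀ i ∈ s, IsCentroidal (S i)) : IsCentroidal (∑ i ∈ s, c i • S i) := by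
  intro a b
  simp only [LinearMap.sum_apply, LinearMap.smul_apply, Finset.sum_mul, Finset.mul_sum,
    smul_mul_assoc, mul_smul_comm]
  exact ⟨Finset.sum_congr rfl fun i hi => by rw [(hS i hi a b).1],
    Finset.sum_congr rfl fun i hi => by rw [(hS i hi a b).2]⟩

end Centroid

/-- If `T` is a bijective averaging operator on `A` and `P(t) = c₁ t + ⋯ + c_m t^m` is a
polynomial with zero constant term, then `P(T) = c₁ T + ⋯ + c_m T^m` is an averaging
operator on `A`. -/
theorem averaging_polynomial {k A : Type*} [Field k] [CharZero k] [NonUnitalRing A]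
    [Module k A] [SMulCommClass k A A] [IsScalarTower k A A]
    (T : A →ₗ[k] A) (hbij : Function.Bijective T) (hT : IsAveragingOperator T)
    (m : ℕ) (c : ℕ → k) :
    IsAveragingOperator (∑ i ∈ Finset.Icc 1 m, c i • T ^ i) := by
  exact (IsCentroidal.sum_smul _ c fun i _ =>
    (hT.isCentroidal hbij).pow i).isAveragingOperator
end

section
/- Let N : A → A be a k-linear map. Then: (1) if N ∘ N = 0, then N is a Nijenhuis operator on A if and only if N is a Rota-Baxter operator of weight 0 on A; (2) if N ∘ N = N, then N is a Nijenhuis operator on A if and only if N is a Rota-Baxter operator of weight −1 on A; (3) if N ∘ N = id_A, then N is a Nijenhuis operator on A if and only if N + id_A is a Rota-Baxter operator of weight −2 on A, if and only if N − id_A is a Rota-Baxter operator of weight 2 on A. -/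
/-- A Nijenhuis operator on a (not necessarily unital or commutative) associative
`k`-algebra `A` is a `k`-linear map `N : A → A` with
`N a * N b = N (N a * b + a * N b - N (a * b))` for all `a b : A`. -/
def IsNijenhuisOperator {k A : Type*} [Field k] [NonUnitalRing A] [Module k A]
    [SMulCommClass k A A] [IsScalarTower k A A] (N : A →ₗ[k] A) : Prop :=
  ∀ a b : A, N a * N b = N (N a * b + a * N b - N (a * b))

/-- A Rota-Baxter operator of weight `λ` on a (not necessarily unital or commutative)
associative `k`-algebra `A` is a `k`-linear map `R : A → A` with
`R a * R b = R (R a * b + a * R b + λ • (a * b))` for all `a b : A`. -/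
def IsRotaBaxterOperator {k A : Type*} [Field k] [NonUnitalRing A] [Module k A]
    [SMulCommClass k A A] [IsScalarTower k A A] (lam : k) (R : A →ₗ[k] A) : Prop :=
  ∀ a b : A, R a * R b = R (R a * b + a * R b + lam • (a * b))

/-- Interrelations between Nijenhuis operators and Rota-Baxter operators:
(1) if `N² = 0` then `N` is Nijenhuis iff `N` is Rota-Baxter of weight `0`;
(2) if `N² = N` then `N` is Nijenhuis iff `N` is Rota-Baxter of weight `-1`;
(3) if `N² = id` then `N` is Nijenhuis iff `N + id` is Rota-Baxter of weight `-2`,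
    iff `N - id` is Rota-Baxter of weight `2`. -/
theorem nijenhuis_iff_rotaBaxter {k A : Type*} [Field k] [CharZero k] [NonUnitalRing A]
    [Module k A] [SMulCommClass k A A] [IsScalarTower k A A] (N : A →ₗ[k] A) :
    (N ∘ₗ N = 0 → (IsNijenhuisOperator N ↔ IsRotaBaxterOperator (0 : k) N)) ∧
    (N ∘ₗ N = N → (IsNijenhuisOperator N ↔ IsRotaBaxterOperator (-1 : k) N)) ∧
    (N ∘ₗ N = LinearMap.id →
      ((IsNijenhuisOperator N ↔ IsRotaBaxterOperator (-2 : k) (N + LinearMap.id)) ∧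
       (IsNijenhuisOperator N ↔ IsRotaBaxterOperator (2 : k) (N - LinearMap.id)))) := by
  refine ⟨fun hN => ?_, fun hN => ?_, fun hN => ⟨?_, ?_⟩⟩ <;>
    refine forall₂_congr fun a b => ?_ <;>
    have h : N (N (a * b)) = _ := LinearMap.congr_fun hN (a * b)
  · simp [h]
  · simp [h, sub_eq_add_neg]
  · have key : (N a + a) * (N b + b) -
        (N + LinearMap.id : A →ₗ[k] A) ((N a + a) * b + a * (N b + b) + (-2 : k) • (a * b)) =
        N a * N b - N (N a * b + a * N b - N (a * b)) := by
      simp only [LinearMap.add_apply, LinearMap.id_apply, map_add, map_sub, map_smul, add_mul,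
        mul_add, h]
      module
    exact sub_eq_zero.symm.trans (key ▸ sub_eq_zero)
  · have key : (N a - a) * (N b - b) -
        (N - LinearMap.id : A →ₗ[k] A) ((N a - a) * b + a * (N b - b) + (2 : k) • (a * b)) =
        N a * N b - N (N a * b + a * N b - N (a * b)) := by
      simp only [LinearMap.sub_apply, LinearMap.id_apply, map_add, map_sub, map_smul, sub_mul,
        mul_sub, h]
      module
    exact sub_eq_zero.symm.trans (key ▸ sub_eq_zero)
end

section
/- Let N be a Nijenhuis operator on A which is bijective. Then the inverse map N⁻¹ : A → A is also a Nijenhuis operator on A. -/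
/-- If `N` is a bijective Nijenhuis operator on `A`, then its inverse is also a
Nijenhuis operator on `A`. -/
theorem nijenhuis_inv {k A : Type*} [Field k] [CharZero k] [NonUnitalRing A]
    [Module k A] [SMulCommClass k A A] [IsScalarTower k A A]
    (N : A ≃ₗ[k] A) (hN : IsNijenhuisOperator (N : A →ₗ[k] A)) :
    IsNijenhuisOperator (N.symm : A →ₗ[k] A) := by
  intro a b
  obtain ⟨x, rfl⟩ := N.surjective a
  obtain ⟨y, rfl⟩ := N.surjective b
  have h : N x * N y = N (N x * y + x * N y - N (x * y)) := hN x y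
  have h' : N.symm (N x * N y) = N x * y + x * N y - N (x * y) :=
    N.symm_apply_eq.mpr h
  simp only [LinearEquiv.coe_coe, LinearEquiv.symm_apply_apply, h']
  rw [LinearEquiv.eq_symm_apply]
  abel
end

section
/- Let N be a Nijenhuis operator on A. Then for all integers i, j ≥ 0 (with N⁰ = id_A) and all a, b ∈ A: Nⁱ(a)·Nʲ(b) − Nʲ(Nⁱ(a)·b) − Nⁱ(a·Nʲ(b)) + N^{i+j}(a·b) = 0. -/
/-- The Nijenhuis identity with a power of the operator on the left factor. -/
theorem IsNijenhuisOperator.pow_apply_mul_apply {k A : Type*} [Field k] [NonUnitalRing A]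
    [Module k A] [SMulCommClass k A A] [IsScalarTower k A A]
    {N : A →ₗ[k] A} (hN : IsNijenhuisOperator N) (i : ℕ) (a b : A) :
    (N ^ i) a * N b = N ((N ^ i) a * b) + (N ^ i) (a * N b) - (N ^ (i + 1)) (a * b) := by
  induction i with
  | zero => simp
  | succ i ih =>
    have h := hN ((N ^ i) a) b
    rw [ih] at h
    simp only [pow_succ' N, Module.End.mul_apply, map_add, map_sub] at h ⊢
    rw [h]
    abel

/-- The Nijenhuis identity with powers of the operator on both factors. -/
theorem IsNijenhuisOperator.pow_apply_mul_pow_apply {k A : Type*} [Field k] [NonUnitalRing A]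
    [Module k A] [SMulCommClass k A A] [IsScalarTower k A A]
    {N : A →ₗ[k] A} (hN : IsNijenhuisOperator N) (i j : ℕ) (a b : A) :
    (N ^ i) a * (N ^ j) b =
      (N ^ j) ((N ^ i) a * b) + (N ^ i) (a * (N ^ j) b) - (N ^ (i + j)) (a * b) := by
  induction j with
  | zero => simp
  | succ j ih =>
    have h := hN.pow_apply_mul_apply i a ((N ^ j) b)
    rw [ih] at h
    simp only [← add_assoc, pow_succ' N, Module.End.mul_apply, map_add, map_sub] at h ⊢
    rw [h]
    abel

/-- If `N` is a Nijenhuis operator on `A`, then for all `i j ≥ 0` (with `N⁰ = id`) and all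
`a b : A`, `Nⁱ a * Nʲ b − Nʲ (Nⁱ a * b) − Nⁱ (a * Nʲ b) + N^(i+j) (a * b) = 0`. -/
theorem nijenhuis_pow_identity {k A : Type*} [Field k] [CharZero k] [NonUnitalRing A]
    [Module k A] [SMulCommClass k A A] [IsScalarTower k A A]
    (N : A →ₗ[k] A) (hN : IsNijenhuisOperator N) (i j : ℕ) (a b : A) :
    (N ^ i) a * (N ^ j) b - (N ^ j) ((N ^ i) a * b) - (N ^ i) (a * (N ^ j) b)
      + (N ^ (i + j)) (a * b) = 0 := by
  rw [hN.pow_apply_mul_pow_apply]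
  abel
end

section
/- Let N be a Nijenhuis operator on A and let F(t) = Σ_{i=0}^{n} cᵢ tⁱ ∈ k[t] be any polynomial. Then the operator F(N) = Σ_{i=0}^{n} cᵢ Nⁱ : A → A (with N⁰ = id_A) is also a Nijenhuis operator on A. -/
/-- Two linear maps satisfying the polarized Nijenhuis identity. -/
def IsNijenhuisPair {k A : Type*} [Field k] [NonUnitalRing A] [Module k A]
    (P Q : A →ₗ[k] A) : Prop :=
  ∀ a b : A, P a * Q b = Q (P a * b) + P (a * Q b) - P (Q (a * b))

namespace IsNijenhuisPair

variable {k A : Type*} [Field k] [NonUnitalRing A] [Module k A]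

theorem one_right (P : A →ₗ[k] A) : IsNijenhuisPair P 1 := fun a b => by simp

theorem one_left (Q : A →ₗ[k] A) : IsNijenhuisPair 1 Q := fun a b => by simp

theorem mul_right {P Q R : A →ₗ[k] A} (hQ : IsNijenhuisPair P Q) (hR : IsNijenhuisPair P R)
    (h : Commute P Q) : IsNijenhuisPair P (Q * R) := fun a b => by
  have hc (x : A) : P (Q x) = Q (P x) := LinearMap.congr_fun h.eq x
  simp only [Module.End.mul_apply]
  rw [hQ, hR]
  simp only [map_add, map_sub, hc]
  abel

theorem mul_left {P Q R : A →ₗ[k] A} (hP : IsNijenhuisPair P R) (hQ : IsNijenhuisPair Q R)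
    (h : Commute P R) : IsNijenhuisPair (P * Q) R := fun a b => by
  have hc (x : A) : P (R x) = R (P x) := LinearMap.congr_fun h.eq x
  simp only [Module.End.mul_apply]
  rw [hP, hQ]
  simp only [map_add, map_sub, hc]
  abel

theorem pow_right {P Q : A →ₗ[k] A} (hQ : IsNijenhuisPair P Q) (h : Commute P Q) (n : ℕ) :
    IsNijenhuisPair P (Q ^ n) := by
  induction n with
  | zero => exact one_right P
  | succ n ih => rw [pow_succ']; exact hQ.mul_right ih h

theorem pow_left {P Q : A →ₗ[k] A} (hP : IsNijenhuisPair P Q) (h : Commute P Q) (n : ℕ) :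
    IsNijenhuisPair (P ^ n) Q := by
  induction n with
  | zero => exact one_left Q
  | succ n ih => rw [pow_succ']; exact hP.mul_left ih h

variable {ι : Type*}

theorem sum_smul_right [SMulCommClass k A A] {P : A →ₗ[k] A} (s : Finset ι) (c : ι → k)
    {Q : ι → A →ₗ[k] A}
    (hQ : ∀ i ∈ s, IsNijenhuisPair P (Q i)) :
    IsNijenhuisPair P (∑ i ∈ s, c i • Q i) := fun a b => by
  simp only [LinearMap.sum_apply, LinearMap.smul_apply, Finset.mul_sum, mul_smul_comm, map_sum,
    map_smul, ← Finset.sum_add_distrib, ← Finset.sum_sub_distrib, ← smul_add, ← smul_sub]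
  exact Finset.sum_congr rfl fun i hi => by rw [hQ i hi]

theorem sum_smul_left [IsScalarTower k A A] {Q : A →ₗ[k] A} (s : Finset ι) (c : ι → k)
    {P : ι → A →ₗ[k] A}
    (hP : ∀ i ∈ s, IsNijenhuisPair (P i) Q) :
    IsNijenhuisPair (∑ i ∈ s, c i • P i) Q := fun a b => by
  simp only [LinearMap.sum_apply, LinearMap.smul_apply, Finset.sum_mul, smul_mul_assoc, map_sum,
    map_smul, ← Finset.sum_add_distrib, ← Finset.sum_sub_distrib, ← smul_add, ← smul_sub]
  exact Finset.sum_congr rfl fun i hi => by rw [hP i hi]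

end IsNijenhuisPair

theorem isNijenhuisOperator_iff_isNijenhuisPair {k A : Type*} [Field k] [NonUnitalRing A]
    [Module k A] [SMulCommClass k A A] [IsScalarTower k A A] {N : A →ₗ[k] A} :
    IsNijenhuisOperator N ↔ IsNijenhuisPair N N := by
  simp only [IsNijenhuisOperator, IsNijenhuisPair, map_add, map_sub]

/-- If `N` is a Nijenhuis operator on `A` and `F(t) = Σ_{i=0}^{n} cᵢ tⁱ` is any polynomial,
then `F(N) = Σ_{i=0}^{n} cᵢ Nⁱ` (with `N⁰ = id`) is also a Nijenhuis operator on `A`. -/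
theorem nijenhuis_polynomial {k A : Type*} [Field k] [CharZero k] [NonUnitalRing A]
    [Module k A] [SMulCommClass k A A] [IsScalarTower k A A]
    (N : A →ₗ[k] A) (hN : IsNijenhuisOperator N) (n : ℕ) (c : ℕ → k) :
    IsNijenhuisOperator (∑ i ∈ Finset.range (n + 1), c i • N ^ i) := by
  rw [isNijenhuisOperator_iff_isNijenhuisPair] at hN ⊢
  exact .sum_smul_right _ _ fun j _ => .sum_smul_left _ _ fun i _ =>
    (hN.pow_right (Commute.refl N) j).pow_left ((Commute.refl N).pow_right j) i
end

section
/- Let T be an averaging operator on A. Then the bracket [a, b]_T := a·T(b) − b·T(a) is k-bilinear, alternating ([a, a]_T = 0), and satisfies the Jacobi identity, so that (A, [·,·]_T) is a Lie algebra over k. -/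
/-- If `T` is an averaging operator on `A`, then `[a, b]_T := a * T b - b * T a` is
`k`-bilinear, alternating and satisfies the Jacobi identity, i.e. it makes `A` a Lie
algebra over `k`. -/
theorem averaging_lie_bracket {k A : Type*} [Field k] [CharZero k] [NonUnitalRing A]
    [Module k A] [SMulCommClass k A A] [IsScalarTower k A A]
    (T : A →ₗ[k] A) (hT : IsAveragingOperator T) :
    let br : A → A → A := fun a b => a * T b - b * T a
    (∀ a b c : A, br (a + b) c = br a c + br b c) ∧
    (∀ a b c : A, br a (b + c) = br a b + br a c) ∧
    (∀ (μ : k) (a b : A), br (μ • a) b = μ • br a b) ∧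
    (∀ (μ : k) (a b : A), br a (μ • b) = μ • br a b) ∧
    (∀ a : A, br a a = 0) ∧
    (∀ a b c : A, br a (br b c) + br b (br c a) + br c (br a b) = 0) := by
  have hmul : ∀ a b : A, T (a * T b) = T a * T b := fun a b => (hT a b).2.symm
  refine ⟨fun a b c => ?_, fun a b c => ?_, fun μ a b => ?_, fun μ a b => ?_,
    fun a => sub_self _, fun a b c => ?_⟩
  · simp only [map_add, mul_add, add_mul]
    abel
  · simp only [map_add, mul_add, add_mul]
    abel
  · simp only [map_smul, smul_mul_assoc, mul_smul_comm, smul_sub]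
  · simp only [map_smul, smul_mul_assoc, mul_smul_comm, smul_sub]
  · simp only [map_sub, hmul, mul_sub, sub_mul, mul_assoc]
    abel
end

section
/- Let N be a Nijenhuis operator on A, and define three bilinear operations on A by a ▷ b = N(a)·b, a ◁ b = a·N(b), and a ◇ b = −N(a·b). Then for all a, b, c ∈ A the following NS-algebra identities hold: (i) a ▷ (b ◁ c) = (a ▷ b) ◁ c; (ii) a ▷ (b ▷ c) = (a ▷ b + a ◁ b + a ◇ b) ▷ c; (iii) a ◁ (b ▷ c + b ◁ c + b ◇ c) = (a ◁ b) ◁ c; (iv) a ▷ (b ◇ c) − (a ▷ b + a ◁ b + a ◇ b) ◇ c = (a ◇ b) ◁ c − a ◇ (b ▷ c + b ◁ c + b ◇ c). -/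
/-- A Nijenhuis operator `N` on `A` induces an NS-algebra structure on `A` via
`a ▷ b = N a * b`, `a ◁ b = a * N b` and `a ◇ b = -N (a * b)`. -/
theorem nijenhuis_NS_algebra {k A : Type*} [Field k] [CharZero k] [NonUnitalRing A]
    [Module k A] [SMulCommClass k A A] [IsScalarTower k A A]
    (N : A →ₗ[k] A) (hN : IsNijenhuisOperator N) :
    let tr : A → A → A := fun a b => N a * b      -- a ▷ b
    let tl : A → A → A := fun a b => a * N b      -- a ◁ b
    let di : A → A → A := fun a b => -N (a * b)   -- a ◇ b
    (∀ a b c : A, tr a (tl b c) = tl (tr a b) c) ∧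
    (∀ a b c : A, tr a (tr b c) = tr (tr a b + tl a b + di a b) c) ∧
    (∀ a b c : A, tl a (tr b c + tl b c + di b c) = tl (tl a b) c) ∧
    (∀ a b c : A, tr a (di b c) - di (tr a b + tl a b + di a b) c
      = tl (di a b) c - di a (tr b c + tl b c + di b c)) := by
  have h : ∀ a b : A, N a * N b = N (N a * b) + N (a * N b) - N (N (a * b)) := fun a b => by
    rw [hN a b, map_sub, map_add]
  refine ⟨fun a b c => (mul_assoc _ _ _).symm, fun a b c => ?_, fun a b c => ?_, fun a b c => ?_⟩
  · simp only [← sub_eq_add_neg]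
    rw [← mul_assoc, hN a b]
  · simp only [← sub_eq_add_neg]
    rw [mul_assoc, hN b c]
  · simp only [mul_neg, neg_mul, h, add_mul, mul_add, map_add, map_neg, mul_assoc]
    abel
end

section
/- Let R be a Reynolds operator of weight λ on A, and define a new product on A by a ⋆ b := a·R(b) + R(a)·b + λ·R(a)·R(b). Then: (1) the product ⋆ is associative, so (A, ⋆) is an associative k-algebra; and (2) R is a Reynolds operator of weight λ on (A, ⋆), i.e. R(a) ⋆ R(b) = R(R(a) ⋆ b + a ⋆ R(b) + λ R(a) ⋆ R(b)) for all a, b ∈ A. -/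
/-- A Reynolds operator of weight `λ` on a (not necessarily unital or commutative)
associative `k`-algebra `A` is a `k`-linear map `R : A → A` with
`R a * R b = R (R a * b + a * R b + λ • (R a * R b))` for all `a b : A`. -/
def IsReynoldsOperator {k A : Type*} [Field k] [NonUnitalRing A] [Module k A]
    [SMulCommClass k A A] [IsScalarTower k A A] (lam : k) (R : A →ₗ[k] A) : Prop :=
  ∀ a b : A, R a * R b = R (R a * b + a * R b + lam • (R a * R b))

/-- If `R` is a Reynolds operator of weight `λ` on `A` and
`a ⋆ b := a * R b + R a * b + λ • (R a * R b)`, then `⋆` is associative and `R` is a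
Reynolds operator of weight `λ` on `(A, ⋆)`. -/
theorem reynolds_new_product {k A : Type*} [Field k] [CharZero k] [NonUnitalRing A]
    [Module k A] [SMulCommClass k A A] [IsScalarTower k A A]
    (lam : k) (R : A →ₗ[k] A) (hR : IsReynoldsOperator lam R) :
    let star : A → A → A := fun a b => a * R b + R a * b + lam • (R a * R b)
    (∀ a b c : A, star (star a b) c = star a (star b c)) ∧
    (∀ a b : A, star (R a) (R b)
      = R (star (R a) b + star a (R b) + lam • star (R a) (R b))) := by
  intro star
  have map_star : ∀ a b : A, R (star a b) = R a * R b := fun a b => by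
    rw [hR a b, add_comm (R a * b)]
  refine ⟨fun a b c => ?_, fun a b => ?_⟩
  · change star a b * R c + R (star a b) * c + lam • (R (star a b) * R c)
      = a * R (star b c) + R a * star b c + lam • (R a * R (star b c))
    simp only [map_star, star, add_mul, mul_add, smul_mul_assoc, mul_smul_comm, mul_assoc]
    abel
  · rw [map_add, map_add, map_smul, map_star, map_star, map_star]
    simp only [star]
    abel
end
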